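/- arXiv:2301.00679 — 2 statements merged into one kernel-verified Lean document; each statement's English description precedes it below -/
import Mathlib

section
/- Let n be a positive integer with n ≤ 8, and let x₁, …, xₙ be nonnegative real numbers, with indices taken cyclically so that x_{n+1} = x₁. Then (Σᵢ₌₁ⁿ xᵢ³)² ≥ (Σᵢ₌₁ⁿ xᵢ²)(Σᵢ₌₁ⁿ xᵢ² x_{i+1}²). -/
/-- The discrete Fourier decomposition of a mean-zero function on the cycle of length eight. -/
theorem exists_fourier_coeff_eight {h : ℝ} (hh : h ^ 2 = 1 / 2) (f : ℕ → ℝ)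
    (hf : ∑ i ∈ Finset.range 8, f i = 0) :
    ∃ p q a b u v k : ℝ,
      f 0 = p + (a + u + k) ∧ f 1 = h * (p + q) + (b + h * (v - u) - k) ∧
      f 2 = q + (-a - v + k) ∧ f 3 = h * (q - p) + (-b + h * (u + v) - k) ∧
      f 4 = -p + (a - u + k) ∧ f 5 = -(h * (p + q)) + (b - h * (v - u) - k) ∧
      f 6 = -q + (-a + v + k) ∧ f 7 = -(h * (q - p)) + (-b - h * (u + v) - k) := by
  simp only [Finset.sum_range_succ, Finset.sum_range_zero] at hf
  refine ⟨((f 0 - f 4) / 2 + h * ((f 1 - f 5) / 2 - (f 3 - f 7) / 2)) / 2,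
    ((f 2 - f 6) / 2 + h * ((f 1 - f 5) / 2 + (f 3 - f 7) / 2)) / 2,
    (f 0 - f 2 + f 4 - f 6) / 4, (f 1 - f 3 + f 5 - f 7) / 4,
    ((f 0 - f 4) / 2 - h * ((f 1 - f 5) / 2 - (f 3 - f 7) / 2)) / 2,
    (h * ((f 1 - f 5) / 2 + (f 3 - f 7) / 2) - (f 2 - f 6) / 2) / 2,
    (f 0 - f 1 + f 2 - f 3 + f 4 - f 5 + f 6 - f 7) / 8, ?_, ?_, ?_, ?_, ?_, ?_, ?_, ?_⟩
  · linear_combination hf / 8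
  · linear_combination hf / 8 - (f 1 - f 5) * hh
  · linear_combination hf / 8
  · linear_combination hf / 8 - (f 3 - f 7) * hh
  · linear_combination hf / 8
  · linear_combination hf / 8 + (f 1 - f 5) * hh
  · linear_combination hf / 8
  · linear_combination hf / 8 + (f 3 - f 7) * hh

theorem sum_add_pow_four_le {ι : Type*} (s : Finset ι) (m e : ι → ℝ) {X : ℝ}
    (hm : ∀ i ∈ s, m i ^ 2 ≤ X) :
    ∑ i ∈ s, (m i + e i) ^ 4 ≤
      ∑ i ∈ s, m i ^ 4 + 4 * ∑ i ∈ s, m i ^ 3 * e i + 8 * X * ∑ i ∈ s, e i ^ 2 +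
        3 * (∑ i ∈ s, e i ^ 2) ^ 2 := by
  have h1 : ∑ i ∈ s, (m i + e i) ^ 4 ≤
      ∑ i ∈ s, (m i ^ 4 + 4 * (m i ^ 3 * e i) + 8 * X * e i ^ 2 + 3 * (e i ^ 2) ^ 2) := by
    refine Finset.sum_le_sum fun i hi => ?_
    nlinarith [mul_nonneg (sub_nonneg.2 (hm i hi)) (sq_nonneg (e i)),
      sq_nonneg (m i * e i - e i ^ 2)]
  have h2 : ∑ i ∈ s, (e i ^ 2) ^ 2 ≤ (∑ i ∈ s, e i ^ 2) ^ 2 :=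
    Finset.sum_sq_le_sq_sum_of_nonneg fun i _ => sq_nonneg (e i)
  simp only [Finset.sum_add_distrib, ← Finset.mul_sum] at h1
  linarith

/-- A bound for the fourth moment of a mean-zero function on the cycle of length eight in terms of
its Fourier coefficients. -/
theorem sum_pow_four_le_fourier {h p q a b u v k X Y : ℝ} (hh : h ^ 2 = 1 / 2)
    (hX : X = p ^ 2 + q ^ 2) (hY : Y = 4 * (a ^ 2 + b ^ 2 + u ^ 2 + v ^ 2) + 8 * k ^ 2) :
    (p + (a + u + k)) ^ 4 + (h * (p + q) + (b + h * (v - u) - k)) ^ 4 +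
      (q + (-a - v + k)) ^ 4 + (h * (q - p) + (-b + h * (u + v) - k)) ^ 4 +
      (-p + (a - u + k)) ^ 4 + (-(h * (p + q)) + (b - h * (v - u) - k)) ^ 4 +
      (-q + (-a + v + k)) ^ 4 + (-(h * (q - p)) + (-b - h * (u + v) - k)) ^ 4 ≤
        3.5 * X ^ 2 + 10 * X * Y + 3 * Y ^ 2 := by
  have hX0 : 0 ≤ X := by rw [hX]; positivity
  have h4 : h ^ 4 = 1 / 4 := by rw [show h ^ 4 = (h ^ 2) ^ 2 by ring, hh]; norm_num
  have hm0 : p ^ 2 ≤ X := by linarith [sq_nonneg q]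
  have hm1 : (h * (p + q)) ^ 2 ≤ X := by
    rw [mul_pow, hh, hX]; linarith [sq_nonneg (p - q)]
  have hm2 : q ^ 2 ≤ X := by linarith [sq_nonneg p]
  have hm3 : (h * (q - p)) ^ 2 ≤ X := by
    rw [mul_pow, hh, hX]; linarith [sq_nonneg (p + q)]
  have key := sum_add_pow_four_le Finset.univ
    ![p, h * (p + q), q, h * (q - p), -p, -(h * (p + q)), -q, -(h * (q - p))]
    ![a + u + k, b + h * (v - u) - k, -a - v + k, -b + h * (u + v) - k, a - u + k,
      b - h * (v - u) - k, -a + v + k, -b - h * (u + v) - k] (X := X) (by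
    intro i _
    fin_cases i
    exacts [hm0, hm1, hm2, hm3, (neg_sq _).trans_le hm0, (neg_sq _).trans_le hm1,
      (neg_sq _).trans_le hm2, (neg_sq _).trans_le hm3])
  rw [Fin.sum_univ_eight, Fin.sum_univ_eight, Fin.sum_univ_eight, Fin.sum_univ_eight] at key
  change _ ≤ p ^ 4 + (h * (p + q)) ^ 4 + q ^ 4 + (h * (q - p)) ^ 4 + (-p) ^ 4 +
      (-(h * (p + q))) ^ 4 + (-q) ^ 4 + (-(h * (q - p))) ^ 4 +
    4 * (p ^ 3 * (a + u + k) + (h * (p + q)) ^ 3 * (b + h * (v - u) - k) +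
      q ^ 3 * (-a - v + k) + (h * (q - p)) ^ 3 * (-b + h * (u + v) - k) +
      (-p) ^ 3 * (a - u + k) + (-(h * (p + q))) ^ 3 * (b - h * (v - u) - k) +
      (-q) ^ 3 * (-a + v + k) + (-(h * (q - p))) ^ 3 * (-b - h * (u + v) - k)) +
    8 * X * ((a + u + k) ^ 2 + (b + h * (v - u) - k) ^ 2 + (-a - v + k) ^ 2 +
      (-b + h * (u + v) - k) ^ 2 + (a - u + k) ^ 2 + (b - h * (v - u) - k) ^ 2 +
      (-a + v + k) ^ 2 + (-b - h * (u + v) - k) ^ 2) +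
    3 * ((a + u + k) ^ 2 + (b + h * (v - u) - k) ^ 2 + (-a - v + k) ^ 2 +
      (-b + h * (u + v) - k) ^ 2 + (a - u + k) ^ 2 + (b - h * (v - u) - k) ^ 2 +
      (-a + v + k) ^ 2 + (-b - h * (u + v) - k) ^ 2) ^ 2 at key
  have hee : (a + u + k) ^ 2 + (b + h * (v - u) - k) ^ 2 + (-a - v + k) ^ 2 +
      (-b + h * (u + v) - k) ^ 2 + (a - u + k) ^ 2 + (b - h * (v - u) - k) ^ 2 +
      (-a + v + k) ^ 2 + (-b - h * (u + v) - k) ^ 2 = Y := by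
    rw [hY]
    linear_combination (4 * (u ^ 2 + v ^ 2)) * hh
  have hmm : p ^ 4 + (h * (p + q)) ^ 4 + q ^ 4 + (h * (q - p)) ^ 4 + (-p) ^ 4 +
      (-(h * (p + q))) ^ 4 + (-q) ^ 4 + (-(h * (q - p))) ^ 4 = 3 * X ^ 2 := by
    rw [hX]
    linear_combination (2 * ((p + q) ^ 4 + (q - p) ^ 4)) * h4
  have hme : p ^ 3 * (a + u + k) + (h * (p + q)) ^ 3 * (b + h * (v - u) - k) +
      q ^ 3 * (-a - v + k) + (h * (q - p)) ^ 3 * (-b + h * (u + v) - k) +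
      (-p) ^ 3 * (a - u + k) + (-(h * (p + q))) ^ 3 * (b - h * (v - u) - k) +
      (-q) ^ 3 * (-a + v + k) + (-(h * (q - p))) ^ 3 * (-b - h * (u + v) - k) =
      (p ^ 3 - 3 * p * q ^ 2) * u + (3 * p ^ 2 * q - q ^ 3) * v := by
    linear_combination (2 * ((p + q) ^ 3 * (v - u) + (q - p) ^ 3 * (u + v))) * h4
  have hcub : 4 * ((p ^ 3 - 3 * p * q ^ 2) * u + (3 * p ^ 2 * q - q ^ 3) * v) ≤
      0.5 * X ^ 2 + 8 * X * (u ^ 2 + v ^ 2) := by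
    rw [hX]
    linear_combination (1 / 2) * sq_nonneg (p ^ 2 - q ^ 2 - 4 * (p * u + q * v)) +
      (1 / 2) * sq_nonneg (2 * p * q - 4 * (p * v - q * u))
  have hrest : 0 ≤ X * (Y - 4 * (u ^ 2 + v ^ 2)) :=
    mul_nonneg hX0 (by linarith [sq_nonneg a, sq_nonneg b, sq_nonneg k])
  rw [hmm, hme, hee] at key
  refine key.trans ?_
  linarith

/-- A Sobolev-type inequality on the cycle of length eight. -/
theorem exists_sum_sq_add_sq_le (f : ℕ → ℝ) (hf : ∑ i ∈ Finset.range 8, f i = 0) :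
    ∃ α : ℝ, 0 ≤ α ∧ ∑ i ∈ Finset.range 8, (f i ^ 2 + α) ^ 2 ≤
      8 * α * ∑ i ∈ Finset.range 8, (f i - f ((i + 1) % 8)) ^ 2 := by
  obtain ⟨h, h0, hh⟩ : ∃ h : ℝ, 0 ≤ h ∧ h ^ 2 = 1 / 2 :=
    ⟨√(1 / 2), Real.sqrt_nonneg _, Real.sq_sqrt (by norm_num)⟩
  have h1 : h ≤ 0.7075 := by nlinarith
  obtain ⟨p, q, a, b, u, v, k, e0, e1, e2, e3, e4, e5, e6, e7⟩ :=
    exists_fourier_coeff_eight hh f hf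
  obtain ⟨X, hX⟩ : ∃ X, X = p ^ 2 + q ^ 2 := ⟨_, rfl⟩
  obtain ⟨Y, hY⟩ : ∃ Y, Y = 4 * (a ^ 2 + b ^ 2 + u ^ 2 + v ^ 2) + 8 * k ^ 2 := ⟨_, rfl⟩
  have hX0 : 0 ≤ X := by rw [hX]; positivity
  have hY0 : 0 ≤ Y := by rw [hY]; positivity
  have hS : ∑ i ∈ Finset.range 8, f i ^ 2 = 4 * X + Y := by
    simp only [Finset.sum_range_succ, Finset.sum_range_zero, e0, e1, e2, e3, e4, e5, e6, e7, hX, hY]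
    linear_combination (4 * (p ^ 2 + q ^ 2 + u ^ 2 + v ^ 2) + 8 * (q * v - p * u)) * hh
  have hE : 2.34 * X + 2 * Y ≤ ∑ i ∈ Finset.range 8, (f i - f ((i + 1) % 8)) ^ 2 := by
    have : ∑ i ∈ Finset.range 8, (f i - f ((i + 1) % 8)) ^ 2 =
        (8 - 8 * h) * X + 2 * Y + 8 * h * (u ^ 2 + v ^ 2) + 16 * k ^ 2 := by
      norm_num [Finset.sum_range_succ, e0, e1, e2, e3, e4, e5, e6, e7, hX, hY]
      linear_combination (8 * (p ^ 2 + q ^ 2 + u ^ 2 + v ^ 2) + 16 * (q * v - p * u)) * hh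
    rw [this]
    have : 0 ≤ 8 * h * (u ^ 2 + v ^ 2) := by positivity
    nlinarith [mul_nonneg hX0 (sub_nonneg.2 h1), sq_nonneg k]
  have hQ : ∑ i ∈ Finset.range 8, f i ^ 4 ≤ 3.5 * X ^ 2 + 10 * X * Y + 3 * Y ^ 2 := by
    simp only [Finset.sum_range_succ, Finset.sum_range_zero, e0, e1, e2, e3, e4, e5, e6, e7,
      zero_add]
    exact sum_pow_four_le_fourier hh hX hY
  have hα : 0 ≤ 0.28 * (2.34 * X + 2 * Y) := by positivity
  refine ⟨_, hα, ?_⟩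
  have hsum : ∀ α : ℝ, ∑ i ∈ Finset.range 8, (f i ^ 2 + α) ^ 2 =
      ∑ i ∈ Finset.range 8, f i ^ 4 + 2 * α * ∑ i ∈ Finset.range 8, f i ^ 2 + 8 * α ^ 2 := by
    intro α
    simp only [Finset.sum_range_succ, Finset.sum_range_zero]
    ring
  rw [hsum, hS]
  have := mul_le_mul_of_nonneg_left hE hα
  nlinarith [sq_nonneg (X - 4 * Y), mul_nonneg hX0 hY0, sq_nonneg Y, sq_nonneg X]

/-- A weighted Poincaré inequality on the cycle of length eight. -/
theorem weighted_variance_le_eight (w f : ℕ → ℝ) :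
    (∑ i ∈ Finset.range 8, w i) * (∑ i ∈ Finset.range 8, w i * f i ^ 2) -
        (∑ i ∈ Finset.range 8, w i * f i) ^ 2 ≤
      2 * (∑ i ∈ Finset.range 8, w i ^ 2) *
        ∑ i ∈ Finset.range 8, (f i - f ((i + 1) % 8)) ^ 2 := by
  wlog hf : ∑ i ∈ Finset.range 8, f i = 0 generalizing f
  · have key := this (fun i => f i - (∑ j ∈ Finset.range 8, f j) / 8) (by
      simp only [Finset.sum_sub_distrib, Finset.sum_const, Finset.card_range]
      ring)
    generalize (∑ j ∈ Finset.range 8, f j) / 8 = c at key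
    simp only [sub_sub_sub_cancel_right] at key
    refine le_trans (le_of_eq ?_) key
    simp only [Finset.sum_range_succ, Finset.sum_range_zero]
    ring
  obtain ⟨α, hα, h⟩ := exists_sum_sq_add_sq_le f hf
  have hW : 0 ≤ ∑ i ∈ Finset.range 8, w i ^ 2 := Finset.sum_nonneg fun i _ => sq_nonneg _
  have hE : 0 ≤ ∑ i ∈ Finset.range 8, (f i - f ((i + 1) % 8)) ^ 2 :=
    Finset.sum_nonneg fun i _ => sq_nonneg _
  rcases hα.eq_or_lt with rfl | hα
  · have hz : ∀ i ∈ Finset.range 8, f i = 0 := by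
      have h0 : ∑ i ∈ Finset.range 8, (f i ^ 2 + 0) ^ 2 = 0 :=
        le_antisymm (by simpa using h) (Finset.sum_nonneg fun i _ => sq_nonneg _)
      rw [Finset.sum_eq_zero_iff_of_nonneg fun i _ => sq_nonneg _] at h0
      intro i hi
      simpa using h0 i hi
    have hz2 : ∑ i ∈ Finset.range 8, w i * f i ^ 2 = 0 :=
      Finset.sum_eq_zero fun i hi => by simp [hz i hi]
    rw [hz2]
    nlinarith [sq_nonneg (∑ i ∈ Finset.range 8, w i * f i), mul_nonneg hW hE]
  · have hcs := Finset.sum_mul_sq_le_sq_mul_sq (Finset.range 8) w (fun i => f i ^ 2 + α)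
    have hsplit : ∑ i ∈ Finset.range 8, w i * (f i ^ 2 + α) =
        ∑ i ∈ Finset.range 8, w i * f i ^ 2 + α * ∑ i ∈ Finset.range 8, w i := by
      rw [Finset.mul_sum, ← Finset.sum_add_distrib]
      exact Finset.sum_congr rfl fun i _ => by ring
    rw [hsplit] at hcs
    have hle := hcs.trans (mul_le_mul_of_nonneg_left h hW)
    have hmul : 4 * α * ((∑ i ∈ Finset.range 8, w i) * ∑ i ∈ Finset.range 8, w i * f i ^ 2) ≤
        4 * α * (2 * (∑ i ∈ Finset.range 8, w i ^ 2) *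
          ∑ i ∈ Finset.range 8, (f i - f ((i + 1) % 8)) ^ 2) := by
      nlinarith [sq_nonneg (∑ i ∈ Finset.range 8, w i * f i ^ 2 -
        α * ∑ i ∈ Finset.range 8, w i)]
    have := le_of_mul_le_mul_left hmul (by positivity)
    linarith [sq_nonneg (∑ i ∈ Finset.range 8, w i * f i)]

/-- Shorter cycles embed in the cycle of length eight by repeating a vertex with weight zero. -/
theorem weighted_variance_le {n : ℕ} (hn : 0 < n) (hn8 : n ≤ 8) (w f : ℕ → ℝ) :
    (∑ i ∈ Finset.range n, w i) * (∑ i ∈ Finset.range n, w i * f i ^ 2) -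
        (∑ i ∈ Finset.range n, w i * f i) ^ 2 ≤
      2 * (∑ i ∈ Finset.range n, w i ^ 2) *
        ∑ i ∈ Finset.range n, (f i - f ((i + 1) % n)) ^ 2 := by
  have h := weighted_variance_le_eight (fun i => if i < n then w i else 0)
    (fun i => if i < n then f i else f (n - 1))
  interval_cases n <;> simpa [Finset.sum_range_succ] using h

theorem four_mul_sum_sq_mul_sum_pow_four_le (s : Finset ℕ) (x : ℕ → ℝ) (hx : ∀ i, 0 ≤ x i) :
    4 * ((∑ i ∈ s, x i ^ 2) * ∑ i ∈ s, x i ^ 4) ≤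
      (∑ i ∈ s, x i) * (∑ i ∈ s, x i ^ 5) + 3 * (∑ i ∈ s, x i ^ 3) ^ 2 := by
  have h : 0 ≤ ∑ i ∈ s, ∑ j ∈ s, x i * x j * (x i - x j) ^ 4 :=
    Finset.sum_nonneg fun i _ => Finset.sum_nonneg fun j _ =>
      mul_nonneg (mul_nonneg (hx i) (hx j)) (by positivity)
  have e : ∑ i ∈ s, ∑ j ∈ s, x i * x j * (x i - x j) ^ 4 =
      ∑ i ∈ s, ∑ j ∈ s, (x i ^ 5 * x j - 4 * (x i ^ 4 * x j ^ 2) + 6 * (x i ^ 3 * x j ^ 3) -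
        4 * (x i ^ 2 * x j ^ 4) + x i * x j ^ 5) :=
    Finset.sum_congr rfl fun i _ => Finset.sum_congr rfl fun j _ => by ring
  simp only [Finset.sum_add_distrib, Finset.sum_sub_distrib, ← Finset.mul_sum,
    ← Finset.sum_mul] at e
  nlinarith

theorem sum_range_add_one_mod {n : ℕ} (hn : 0 < n) (g : ℕ → ℝ) :
    ∑ i ∈ Finset.range n, g ((i + 1) % n) = ∑ i ∈ Finset.range n, g i := by
  obtain ⟨m, rfl⟩ := Nat.exists_eq_add_one.2 hn
  rw [Finset.sum_range_succ, Finset.sum_range_succ', Nat.mod_self]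
  congr 1
  refine Finset.sum_congr rfl fun i hi => ?_
  rw [Nat.mod_eq_of_lt (by simpa using hi)]

theorem cyclic_ineq_a1_b1 (n : ℕ) (hn : 0 < n) (hn8 : n ≤ 8) (x : ℕ → ℝ)
    (hx : ∀ i, 0 ≤ x i) :
    (∑ i ∈ Finset.range n, x i ^ 3) ^ 2 ≥
      (∑ i ∈ Finset.range n, x i ^ 2) *
        (∑ i ∈ Finset.range n, x i ^ 2 * x ((i + 1) % n) ^ 2) := by
  have h1 := weighted_variance_le hn hn8 x (fun i => x i ^ 2)
  have h2 := four_mul_sum_sq_mul_sum_pow_four_le (Finset.range n) x hx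
  have hE : ∑ i ∈ Finset.range n, (x i ^ 2 - x ((i + 1) % n) ^ 2) ^ 2 =
      2 * ∑ i ∈ Finset.range n, x i ^ 4 -
        2 * ∑ i ∈ Finset.range n, x i ^ 2 * x ((i + 1) % n) ^ 2 := by
    have hs := sum_range_add_one_mod hn (fun i => x i ^ 4)
    rw [two_mul (∑ i ∈ Finset.range n, x i ^ 4)]
    nth_rewrite 2 [← hs]
    rw [Finset.mul_sum, ← Finset.sum_add_distrib, ← Finset.sum_sub_distrib]
    exact Finset.sum_congr rfl fun i _ => by ring
  have h5 : ∀ i, x i * (x i ^ 2) ^ 2 = x i ^ 5 := fun i => by ring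
  have h3 : ∀ i, x i * x i ^ 2 = x i ^ 3 := fun i => by ring
  simp only [hE, h5, h3] at h1
  nlinarith
end

section
/- Let n be a positive integer with n ≤ 8, and let x₁, …, xₙ be nonnegative real numbers, with indices taken cyclically so that x_{n+1} = x₁. Then (Σᵢ₌₁ⁿ xᵢ³)² = (Σᵢ₌₁ⁿ xᵢ²)(Σᵢ₌₁ⁿ xᵢ² x_{i+1}²) if and only if x₁ = x₂ = ⋯ = xₙ. -/
open Finset in
/-- The gap in the cyclic cubic inequality
`n ∑ aᵢ³ ≤ (∑ aᵢ) (4 ∑ (aᵢ - aᵢ₊₁)² + ∑ aᵢ²)`. -/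
noncomputable def cyclicCubicGap (n : ℕ) (a : ℕ → ℝ) : ℝ :=
  (∑ i ∈ range n, a i) *
      (4 * ∑ i ∈ range n, (a i - a ((i + 1) % n)) ^ 2 + ∑ i ∈ range n, a i ^ 2) -
    n * ∑ i ∈ range n, a i ^ 3

/-- A positive definite quadratic form in the differences `dⱼ = a_{k+j} - a_k` whose cyclic
average, weighted by `a_k`, is `cyclicCubicGap 8`. -/
noncomputable def pinnedForm (d : ℕ → ℝ) : ℝ :=
  13 / 10 * ((d 1 + d 7) - 16 / 13 * (d 2 + d 6) + 59 / 52 * (d 3 + d 5) - 25 / 26 * d 4) ^ 2 +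
    21 / 260 * ((d 2 + d 6) + 73 / 42 * (d 3 + d 5) - 101 / 21 * d 4) ^ 2 +
    2797 / 3360 * ((d 3 + d 5) - 5062 / 2797 * d 4) ^ 2 +
    9 / 2797 * d 4 ^ 2 +
    19 / 10 * ((d 1 - d 7) - 21 / 19 * (d 2 - d 6) + 25 / 76 * (d 3 - d 5)) ^ 2 +
    771 / 380 * ((d 2 - d 6) - 1609 / 771 * (d 3 - d 5)) ^ 2 +
    25663 / 123360 * (d 3 - d 5) ^ 2

theorem pinnedForm_nonneg (d : ℕ → ℝ) : 0 ≤ pinnedForm d := by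
  unfold pinnedForm
  positivity

theorem pinnedForm_eq (d : ℕ → ℝ) :
    pinnedForm d =
      16 / 5 * (d 1 ^ 2 + d 7 ^ 2) - 37 / 5 * (d 6 * d 7 + d 1 * d 2) +
      21 / 5 * (d 1 * d 3 + d 5 * d 7) - 5 / 2 * (d 4 * d 7 + d 1 * d 4) +
      17 / 10 * (d 3 * d 7 + d 1 * d 5) + (d 1 * d 6 + d 2 * d 7) - 6 / 5 * (d 1 * d 7) +
      32 / 5 * (d 6 ^ 2 + d 2 ^ 2) - 66 / 5 * (d 2 * d 3 + d 5 * d 6) +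
      23 / 10 * (d 2 * d 4 + d 4 * d 6) + 13 / 2 * (d 2 * d 5 + d 3 * d 6) -
      23 / 5 * (d 2 * d 6) + 12 * (d 3 ^ 2 + d 5 ^ 2) - 36 / 5 * (d 4 * d 5 + d 3 * d 4) -
      13 * (d 3 * d 5) + 29 / 5 * d 4 ^ 2 := by
  unfold pinnedForm
  ring

theorem cyclicCubicGap_eight_eq (a : ℕ → ℝ) :
    cyclicCubicGap 8 a =
      ∑ k ∈ Finset.range 8, a k * pinnedForm (fun j => a ((k + j) % 8) - a k) := by
  simp only [cyclicCubicGap, pinnedForm_eq, Finset.sum_range_succ, Finset.sum_range_zero]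
  norm_num
  ring

theorem sum_sum_add_mul_sub_sq (n : ℕ) (a : ℕ → ℝ) :
    ∑ i ∈ Finset.range n, ∑ j ∈ Finset.range n, (a i + a j) * (a i - a j) ^ 2 =
      2 * (n * ∑ i ∈ Finset.range n, a i ^ 3 -
        (∑ i ∈ Finset.range n, a i) * ∑ i ∈ Finset.range n, a i ^ 2) := by
  have h : ∀ i j, (a i + a j) * (a i - a j) ^ 2 =
      a i ^ 3 + a j ^ 3 - a i * a j ^ 2 - a i ^ 2 * a j := fun i j => by ring
  simp only [h, Finset.sum_add_distrib, Finset.sum_sub_distrib, ← Finset.mul_sum,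
    ← Finset.sum_mul, Finset.sum_const, Finset.card_range, nsmul_eq_mul]
  ring

theorem sum_sum_sq_mul_sq_mul_sub_sq (n : ℕ) (x : ℕ → ℝ) :
    ∑ i ∈ Finset.range n, ∑ j ∈ Finset.range n, x i ^ 2 * x j ^ 2 * (x i - x j) ^ 2 =
      2 * ((∑ i ∈ Finset.range n, x i ^ 2) * ∑ i ∈ Finset.range n, x i ^ 4 -
        (∑ i ∈ Finset.range n, x i ^ 3) ^ 2) := by
  have h : ∀ i j, x i ^ 2 * x j ^ 2 * (x i - x j) ^ 2 =
      x i ^ 4 * x j ^ 2 + x i ^ 2 * x j ^ 4 - 2 * (x i ^ 3 * x j ^ 3) := fun i j => by ring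
  simp only [h, Finset.sum_add_distrib, Finset.sum_sub_distrib, ← Finset.mul_sum,
    ← Finset.sum_mul]
  ring

/-- Averaging over the duplication of one entry relates the gaps for `n` and `n + 1`. -/
theorem succ_mul_cyclicCubicGap (n : ℕ) (hn : n < 8) (a : ℕ → ℝ) :
    (n + 1) * cyclicCubicGap n a =
      ∑ m ∈ Finset.range n, cyclicCubicGap (n + 1) (fun i => a (if i ≤ m then i else i - 1)) +
        (n * ∑ i ∈ Finset.range n, a i ^ 3 -
          (∑ i ∈ Finset.range n, a i) * ∑ i ∈ Finset.range n, a i ^ 2) := by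
  interval_cases n <;>
    simp only [cyclicCubicGap, Finset.sum_range_succ, Finset.sum_range_zero] <;>
    norm_num <;> ring

theorem cyclicCubicGap_nonneg {n : ℕ} (hn : n ≤ 8) :
    ∀ a : ℕ → ℝ, (∀ i, 0 ≤ a i) → 0 ≤ cyclicCubicGap n a := by
  induction hn using Nat.decreasingInduction with
  | self =>
    intro a ha
    rw [cyclicCubicGap_eight_eq]
    exact Finset.sum_nonneg fun k _ => mul_nonneg (ha k) (pinnedForm_nonneg _)
  | of_succ n hn ih =>
    intro a ha
    have hdup : 0 ≤ ∑ m ∈ Finset.range n,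
        cyclicCubicGap (n + 1) (fun i => a (if i ≤ m then i else i - 1)) :=
      Finset.sum_nonneg fun m _ => ih _ fun i => ha _
    have hpair : 0 ≤ ∑ i ∈ Finset.range n, ∑ j ∈ Finset.range n,
        (a i + a j) * (a i - a j) ^ 2 :=
      Finset.sum_nonneg fun i _ => Finset.sum_nonneg fun j _ =>
        mul_nonneg (add_nonneg (ha i) (ha j)) (sq_nonneg _)
    rw [sum_sum_add_mul_sub_sq] at hpair
    have hgap := succ_mul_cyclicCubicGap n hn a
    have hpos : (0 : ℝ) < n + 1 := by positivity
    exact nonneg_of_mul_nonneg_right (by linarith) hpos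

theorem sum_range_succ_mod (n : ℕ) (f : ℕ → ℝ) :
    ∑ i ∈ Finset.range n, f ((i + 1) % n) = ∑ i ∈ Finset.range n, f i := by
  cases n with
  | zero => simp
  | succ n =>
    rw [Finset.sum_range_succ, Finset.sum_range_succ', Nat.mod_self]
    congr 1
    refine Finset.sum_congr rfl fun i hi => ?_
    rw [Nat.mod_eq_of_lt (by simpa using hi)]

/-- A sum-of-nonnegatives lower bound for the gap in the sextic cyclic inequality. -/
theorem sum_sum_sub_pow_four_le {n : ℕ} (hn : n ≤ 8) (x : ℕ → ℝ) :
    ∑ i ∈ Finset.range n, ∑ j ∈ Finset.range n,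
        (x i - x j) ^ 4 * (x i ^ 2 + 4 * x i * x j + x j ^ 2) ≤
      16 * ((∑ i ∈ Finset.range n, x i ^ 3) ^ 2 -
        (∑ i ∈ Finset.range n, x i ^ 2) *
          (∑ i ∈ Finset.range n, x i ^ 2 * x ((i + 1) % n) ^ 2)) := by
  have hgap := cyclicCubicGap_nonneg hn (fun i => x i ^ 2) fun i => sq_nonneg _
  have hpair := sum_sum_add_mul_sub_sq n fun i => x i ^ 2
  have hedge : ∑ i ∈ Finset.range n, (x i ^ 2 - x ((i + 1) % n) ^ 2) ^ 2 =
      2 * ∑ i ∈ Finset.range n, x i ^ 4 -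
        2 * ∑ i ∈ Finset.range n, x i ^ 2 * x ((i + 1) % n) ^ 2 := by
    have h : ∀ i, (x i ^ 2 - x ((i + 1) % n) ^ 2) ^ 2 =
        x i ^ 4 + x ((i + 1) % n) ^ 4 - 2 * (x i ^ 2 * x ((i + 1) % n) ^ 2) :=
      fun i => by ring
    simp only [h, Finset.sum_add_distrib, Finset.sum_sub_distrib, ← Finset.mul_sum,
      sum_range_succ_mod n fun i => x i ^ 4]
    ring
  have hsplit : ∀ i j, (x i - x j) ^ 4 * (x i ^ 2 + 4 * x i * x j + x j ^ 2) =
      (x i ^ 2 + x j ^ 2) * (x i ^ 2 - x j ^ 2) ^ 2 -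
        8 * (x i ^ 2 * x j ^ 2 * (x i - x j) ^ 2) := fun i j => by ring
  simp only [hsplit, Finset.sum_sub_distrib, ← Finset.mul_sum, sum_sum_sq_mul_sq_mul_sub_sq]
  rw [hpair]
  rw [cyclicCubicGap, hedge] at hgap
  linarith

theorem cyclic_eq_iff_a1_b1 (n : ℕ) (hn : 0 < n) (hn8 : n ≤ 8) (x : ℕ → ℝ)
    (hx : ∀ i, 0 ≤ x i) :
    (∑ i ∈ Finset.range n, x i ^ 3) ^ 2 =
        (∑ i ∈ Finset.range n, x i ^ 2) *
          (∑ i ∈ Finset.range n, x i ^ 2 * x ((i + 1) % n) ^ 2) ↔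
      ∀ i < n, x i = x 0 := by
  constructor
  · intro h i hi
    have hterm : ∀ i j, 0 ≤ (x i - x j) ^ 4 * (x i ^ 2 + 4 * x i * x j + x j ^ 2) := by
      intro i j
      have := hx i
      have := hx j
      have : 0 ≤ (x i - x j) ^ 4 := by positivity
      positivity
    have hle := sum_sum_sub_pow_four_le hn8 x
    rw [h, sub_self, mul_zero] at hle
    have hzero : (x i - x 0) ^ 4 * (x i ^ 2 + 4 * x i * x 0 + x 0 ^ 2) ≤ 0 :=
      calc _ ≤ ∑ j ∈ Finset.range n, (x i - x j) ^ 4 * (x i ^ 2 + 4 * x i * x j + x j ^ 2) :=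
            Finset.single_le_sum (fun j _ => hterm i j) (Finset.mem_range.2 hn)
        _ ≤ _ := Finset.single_le_sum (f := fun i => ∑ j ∈ Finset.range n,
            (x i - x j) ^ 4 * (x i ^ 2 + 4 * x i * x j + x j ^ 2))
            (fun i _ => Finset.sum_nonneg fun j _ => hterm i j) (Finset.mem_range.2 hi)
        _ ≤ 0 := hle
    rcases mul_eq_zero.1 (le_antisymm hzero (hterm i 0)) with h4 | h2
    · exact sub_eq_zero.1 (pow_eq_zero_iff (by norm_num) |>.1 h4)
    · have hmul := mul_nonneg (hx i) (hx 0)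
      have hi0 : x i = 0 := by nlinarith [sq_nonneg (x i), sq_nonneg (x 0)]
      have h00 : x 0 = 0 := by nlinarith [sq_nonneg (x i), sq_nonneg (x 0)]
      rw [hi0, h00]
  · intro h
    have hconst : ∀ k : ℕ, ∑ i ∈ Finset.range n, x i ^ k = n * x 0 ^ k := by
      intro k
      rw [Finset.sum_congr rfl fun i hi => by rw [h i (Finset.mem_range.1 hi)]]
      simp
    have hprod : ∑ i ∈ Finset.range n, x i ^ 2 * x ((i + 1) % n) ^ 2 = n * x 0 ^ 4 := by
      rw [Finset.sum_congr rfl fun i hi => by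
        rw [h i (Finset.mem_range.1 hi), h _ (Nat.mod_lt _ hn), ← pow_add]]
      simp
    rw [hconst, hconst, hprod]
    ring
end
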